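/- Let E, F, G be real Banach spaces, let U ⊆ E be open, and let k be a natural number. Suppose Φ : U × F → G is of class C^{k,1}_loc (on U × F) and that for every x ∈ U the map Φ(x,·) : F → G is linear. Then for every x ∈ U the map Φ(x,·) is a continuous linear map, and the associated map Φ^∧ : U → L(F,G), x ↦ Φ(x,·), into the space of continuous linear maps equipped with the operator norm, is again of class C^{k,1}_loc. -/

import Mathlib

open Set Filter
open scoped NNReal

/-- A locally Lipschitz map on `U × F` which is linear in the second variable is transposed to a
locally Lipschitz map from `U` to the space of continuous linear maps. -/
theorem exists_locallyLipschitzOn_clm_of_isLinearMap {E F H : Type*}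
    [NormedAddCommGroup E] [NormedSpace ℝ E]
    [NormedAddCommGroup F] [NormedSpace ℝ F] [NormedAddCommGroup H] [NormedSpace ℝ H]
    {U : Set E} (hU : IsOpen U) {f : E × F → H}
    (hlip : LocallyLipschitzOn (U ×ˢ (univ : Set F)) f)
    (hlin : ∀ x ∈ U, IsLinearMap ℝ (fun w : F => f (x, w))) :
    ∃ A : E → (F →L[ℝ] H), (∀ x ∈ U, ∀ w, A x w = f (x, w)) ∧ LocallyLipschitzOn U A := by
  have key : ∀ x ∈ U, ∃ K : ℝ≥0, ∃ t ∈ nhds x, t ⊆ U ∧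
      (∀ y ∈ t, ∀ w, ‖f (y, w)‖ ≤ K * ‖w‖) ∧
      ∀ y ∈ t, ∀ z ∈ t, ∀ w, ‖f (y, w) - f (z, w)‖ ≤ K * ‖y - z‖ * ‖w‖ := by
    intro x hx
    obtain ⟨K, t, ht, hK⟩ := hlip (x := (x, 0)) ⟨hx, mem_univ _⟩
    rw [(hU.prod isOpen_univ).nhdsWithin_eq ⟨hx, mem_univ _⟩] at ht
    obtain ⟨ε, hε, hball⟩ := Metric.mem_nhds_iff.1 ht
    set δ : ℝ := ε / 2
    have hδ0 : 0 < δ := by positivity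
    have hmem : ∀ y ∈ Metric.ball x ε, ∀ w : F, ‖w‖ ≤ δ → (y, w) ∈ t := fun y hy w hw =>
      hball (by
        rw [← ball_prod_same]
        exact ⟨hy, by simpa using lt_of_le_of_lt hw (half_lt_self hε)⟩)
    have hscale : ∀ w : F, w ≠ 0 → ‖(δ / ‖w‖) • w‖ = δ := fun w hw => by
      have : ‖w‖ ≠ 0 := norm_ne_zero_iff.2 hw
      rw [norm_smul, Real.norm_of_nonneg (by positivity)]
      field_simp
    refine ⟨K + K / δ.toNNReal, Metric.ball x ε ∩ U,
      inter_mem (Metric.ball_mem_nhds x hε) (hU.mem_nhds hx), inter_subset_right, ?_, ?_⟩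
    · rintro y ⟨hy, hyU⟩ w
      rcases eq_or_ne w 0 with rfl | hw
      · simpa using (hlin y hyU).map_zero
      have hw0 : 0 < ‖w‖ := norm_pos_iff.2 hw
      have h := hK.norm_sub_le (hmem y hy _ (hscale w hw).le) (hmem y hy 0 (by simpa using hδ0.le))
      rw [(hlin y hyU).map_smul (δ / ‖w‖) w, (hlin y hyU).map_zero, sub_zero, norm_smul,
        Prod.mk_sub_mk, sub_self, sub_zero, Prod.norm_mk, norm_zero, hscale w hw,
        max_eq_right hδ0.le, Real.norm_of_nonneg (by positivity), div_mul_eq_mul_div,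
        div_le_iff₀ hw0] at h
      have h' : ‖f (y, w)‖ ≤ K * ‖w‖ := by
        refine le_of_mul_le_mul_left ?_ hδ0
        linarith
      refine h'.trans ?_
      gcongr
      exact le_add_of_nonneg_right zero_le
    · rintro y ⟨hy, hyU⟩ z ⟨hz, hzU⟩ w
      rcases eq_or_ne w 0 with rfl | hw
      · have h1 : f (y, 0) = 0 := (hlin y hyU).map_zero
        have h2 : f (z, 0) = 0 := (hlin z hzU).map_zero
        simp [h1, h2]
      have hw0 : 0 < ‖w‖ := norm_pos_iff.2 hw
      have h := hK.norm_sub_le (hmem y hy _ (hscale w hw).le) (hmem z hz _ (hscale w hw).le)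
      rw [(hlin y hyU).map_smul (δ / ‖w‖) w, (hlin z hzU).map_smul (δ / ‖w‖) w, ← smul_sub,
        norm_smul, Prod.mk_sub_mk, sub_self, Prod.norm_mk, norm_zero,
        max_eq_left (norm_nonneg _), Real.norm_of_nonneg (by positivity), div_mul_eq_mul_div,
        div_le_iff₀ hw0] at h
      have h' : ‖f (y, w) - f (z, w)‖ ≤ K / δ * ‖y - z‖ * ‖w‖ := by
        rw [div_mul_eq_mul_div, div_mul_eq_mul_div, le_div_iff₀ hδ0]
        linarith
      refine h'.trans ?_
      gcongr
      rw [NNReal.coe_add, NNReal.coe_div, Real.coe_toNNReal _ hδ0.le]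
      exact le_add_of_nonneg_left K.2
  have hA : ∀ x, ∃ A : F →L[ℝ] H, x ∈ U → ∀ w, A w = f (x, w) := by
    intro x
    by_cases hx : x ∈ U
    · obtain ⟨K, t, ht, -, hb, -⟩ := key x hx
      exact ⟨((hlin x hx).mk' _).mkContinuous K (hb x (mem_of_mem_nhds ht)), fun _ _ => rfl⟩
    · exact ⟨0, fun h => absurd h hx⟩
  choose A hA using hA
  refine ⟨A, hA, fun x hx => ?_⟩
  obtain ⟨K, t, ht, htU, -, hd⟩ := key x hx
  refine ⟨K, t, mem_nhdsWithin_of_mem_nhds ht, LipschitzOnWith.of_dist_le_mul fun y hy z hz => ?_⟩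
  rw [dist_eq_norm, dist_eq_norm]
  refine ContinuousLinearMap.opNorm_le_bound _ (by positivity) fun w => ?_
  rw [sub_apply, hA y (htU hy), hA z (htU hz)]
  exact hd y hy z hz w

/-- If a family of continuous linear maps is differentiable pointwise, with a derivative which is
continuous for the operator norm, then it is differentiable for the operator norm. -/
theorem hasFDerivAt_clm_of_forall_apply {E F H : Type*}
    [NormedAddCommGroup E] [NormedSpace ℝ E]
    [NormedAddCommGroup F] [NormedSpace ℝ F] [NormedAddCommGroup H] [NormedSpace ℝ H]
    {U : Set E} (hU : IsOpen U) {A : E → (F →L[ℝ] H)} {B : E → (F →L[ℝ] E →L[ℝ] H)}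
    (hB : ContinuousOn B U) (hA : ∀ x ∈ U, ∀ w, HasFDerivAt (fun y => A y w) (B x w) x)
    {x : E} (hx : x ∈ U) : HasFDerivAt A (B x).flip x := by
  rw [hasFDerivAt_iff_isLittleO, Asymptotics.isLittleO_iff]
  intro c hc
  have hBx : ∀ᶠ y in nhds x, ‖B y - B x‖ < c := by
    have h : Metric.ball (B x) c ∈ nhds (B x) := Metric.ball_mem_nhds (B x) hc
    filter_upwards [(hB.continuousAt (hU.mem_nhds hx)).eventually h] with y hy
    exact (dist_eq_norm (B y) (B x)).symm.trans_lt hy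
  obtain ⟨ε, hε, hball⟩ := Metric.mem_nhds_iff.1 (inter_mem hBx (hU.mem_nhds hx))
  filter_upwards [Metric.ball_mem_nhds x hε] with y hy
  refine ContinuousLinearMap.opNorm_le_bound _ (by positivity) fun w => ?_
  have h := (convex_ball x ε).norm_image_sub_le_of_norm_hasFDerivWithin_le'
    (f := fun y => A y w) (f' := fun y => B y w) (φ := B x w) (C := c * ‖w‖)
    (fun z hz => (hA z (hball hz).2 w).hasFDerivWithinAt)
    (fun z hz => by
      rw [← sub_apply]
      exact (B z - B x).le_of_opNorm_le (hball hz).1.le w)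
    (Metric.mem_ball_self hε) hy
  simp only [sub_apply, ContinuousLinearMap.flip_apply]
  linarith

/-- Restricting the terms of a Taylor series to the first variable yields successive partial
derivatives in that variable. -/
theorem HasFTaylorSeriesUpToOn.hasFDerivAt_compContinuousLinearMap_inl {E F G : Type*}
    [NormedAddCommGroup E] [NormedSpace ℝ E]
    [NormedAddCommGroup F] [NormedSpace ℝ F] [NormedAddCommGroup G] [NormedSpace ℝ G]
    {n : WithTop ℕ∞} {f : E × F → G} {q : E × F → FormalMultilinearSeries ℝ (E × F) G}
    {S : Set (E × F)} (hS : IsOpen S) (h : HasFTaylorSeriesUpToOn n f q S) {m : ℕ} (hm : m < n)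
    {x : E} {w : F} (hx : (x, w) ∈ S) :
    HasFDerivAt
      (fun y => (q (y, w) m).compContinuousLinearMap fun _ => ContinuousLinearMap.inl ℝ E F)
      ((q (x, w) (m + 1)).compContinuousLinearMap
        fun _ => ContinuousLinearMap.inl ℝ E F).curryLeft x := by
  have h1 := (h.fderivWithin m hm _ hx).hasFDerivAt (hS.mem_nhds hx)
  have h2 := (ContinuousMultilinearMap.compContinuousLinearMapL (F := G)
    fun _ : Fin m => ContinuousLinearMap.inl ℝ E F).hasFDerivAt.comp x
      (h1.comp x (hasFDerivAt_prodMk_left x w))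
  convert! h2 using 1
  ext v vs
  simp only [ContinuousMultilinearMap.curryLeft_apply, ContinuousLinearMap.comp_apply,
    ContinuousMultilinearMap.compContinuousLinearMap_apply,
    ContinuousMultilinearMap.compContinuousLinearMapL_apply]
  congr 1
  ext i <;> refine Fin.cases ?_ (fun _ => ?_) i <;> simp

/-- **Exponential law for `C^{k,1}_loc` maps linear in the second variable.**
If `Φ : U × F → G` is of class `C^{k,1}_loc` (i.e. `C^k` with locally Lipschitz `k`-th
derivative) on `U × F` and `Φ (x, ·)` is linear for every `x ∈ U`, then each `Φ (x, ·)` is a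
continuous linear map, and the transposed map `Φ^∧ : U → L(F,G)` is again of class
`C^{k,1}_loc`. -/
theorem exponential_law_CkLip
    {E F G : Type*}
    [NormedAddCommGroup E] [NormedSpace ℝ E] [CompleteSpace E]
    [NormedAddCommGroup F] [NormedSpace ℝ F] [CompleteSpace F]
    [NormedAddCommGroup G] [NormedSpace ℝ G] [CompleteSpace G]
    (U : Set E) (hU : IsOpen U) (k : ℕ) (Φ : E × F → G)
    (hΦ : ContDiffOn ℝ k Φ (U ×ˢ (univ : Set F)))
    (hΦlip : ∀ p ∈ U ×ˢ (univ : Set F), ∃ K : ℝ≥0, ∃ t ∈ nhdsWithin p (U ×ˢ (univ : Set F)),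
        LipschitzOnWith K (iteratedFDerivWithin ℝ k Φ (U ×ˢ (univ : Set F))) t)
    (hΦlin : ∀ x ∈ U, IsLinearMap ℝ (fun w : F => Φ (x, w))) :
    ∃ Φhat : E → (F →L[ℝ] G),
      (∀ x ∈ U, ∀ w : F, Φhat x w = Φ (x, w)) ∧
      ContDiffOn ℝ k Φhat U ∧
      (∀ x ∈ U, ∃ K : ℝ≥0, ∃ t ∈ nhdsWithin x U,
        LipschitzOnWith K (iteratedFDerivWithin ℝ k Φhat U) t) := by
  set S : Set (E × F) := U ×ˢ (univ : Set F)
  have hS : IsOpen S := hU.prod isOpen_univ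
  have hmemS : ∀ {x : E}, x ∈ U → ∀ w : F, (x, w) ∈ S := fun hx w => ⟨hx, mem_univ w⟩
  set q := ftaylorSeriesWithin ℝ Φ S
  have hq : HasFTaylorSeriesUpToOn k Φ q S := hΦ.ftaylorSeriesWithin hS.uniqueDiffOn
  let P : (m : ℕ) → E × F → (E [×m]→L[ℝ] G) := fun m z =>
    (q z m).compContinuousLinearMap fun _ => ContinuousLinearMap.inl ℝ E F
  have hPderiv : ∀ m, m < k → ∀ x ∈ U, ∀ w,
      HasFDerivAt (fun y => P m (y, w)) (P (m + 1) (x, w)).curryLeft x := fun m hm x hx w =>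
    hq.hasFDerivAt_compContinuousLinearMap_inl hS (by exact_mod_cast hm) (hmemS hx w)
  have hPlip : ∀ m, m ≤ k → LocallyLipschitzOn S (P m) := by
    intro m hm z hz
    obtain ⟨K, t, ht, hK⟩ : ∃ K : ℝ≥0, ∃ t ∈ nhdsWithin z S,
        LipschitzOnWith K (iteratedFDerivWithin ℝ m Φ S) t := by
      rcases hm.eq_or_lt with rfl | hm
      · exact hΦlip z hz
      · have h1 : ContDiffWithinAt ℝ 1 (iteratedFDerivWithin ℝ m Φ S) S z :=
          (hΦ z hz).iteratedFDerivWithin_right hS.uniqueDiffOn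
            (by rw [add_comm]; exact_mod_cast hm) hz
        obtain ⟨K, t, ht, hK⟩ := (h1.contDiffAt (hS.mem_nhds hz)).exists_lipschitzOnWith
        exact ⟨K, t, mem_nhdsWithin_of_mem_nhds ht, hK⟩
    exact ⟨_, t, ht, (ContinuousMultilinearMap.compContinuousLinearMapL (F := G)
      fun _ : Fin m => ContinuousLinearMap.inl ℝ E F).lipschitz.comp_lipschitzOnWith hK⟩
  have hP0 : ∀ x ∈ U, ∀ w, ∀ v, P 0 (x, w) v = Φ (x, w) := by
    intro x hx w v
    rw [← hq.zero_eq _ (hmemS hx w)]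
    simp only [P, ContinuousMultilinearMap.compContinuousLinearMap_apply,
      ContinuousMultilinearMap.curry0]
    congr 1
    exact Subsingleton.elim _ _
  have hPlin : ∀ m, m ≤ k → ∀ x ∈ U, IsLinearMap ℝ (fun w => P m (x, w)) := by
    intro m
    induction m with
    | zero =>
      intro _ x hx
      constructor
      · intro w₁ w₂
        ext v
        simpa [hP0 x hx] using (hΦlin x hx).map_add w₁ w₂
      · intro c w
        ext v
        simpa [hP0 x hx] using (hΦlin x hx).map_smul c w
    | succ m ih =>
      intro hm x hx
      have ih := ih (by omega)
      have hd := hPderiv m (by omega) x hx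
      have hUx := hU.mem_nhds hx
      constructor
      · intro w₁ w₂
        have h := (hd (w₁ + w₂)).unique (((hd w₁).add (hd w₂)).congr_of_eventuallyEq
          (by filter_upwards [hUx] with y hy using (ih y hy).map_add w₁ w₂))
        exact (continuousMultilinearCurryLeftEquiv ℝ (fun _ : Fin (m + 1) => E) G).injective h
      · intro c w
        have h := (hd (c • w)).unique (((hd w).const_smul c).congr_of_eventuallyEq
          (by filter_upwards [hUx] with y hy using (ih y hy).map_smul c w))
        exact (continuousMultilinearCurryLeftEquiv ℝ (fun _ : Fin (m + 1) => E) G).injective h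
  have hA : ∀ m, ∃ A : E → (F →L[ℝ] (E [×m]→L[ℝ] G)), m ≤ k →
      (∀ x ∈ U, ∀ w, A x w = P m (x, w)) ∧ LocallyLipschitzOn U A := by
    intro m
    by_cases hm : m ≤ k
    · obtain ⟨A, hA⟩ := exists_locallyLipschitzOn_clm_of_isLinearMap hU (hPlip m hm) (hPlin m hm)
      exact ⟨A, fun _ => hA⟩
    · exact ⟨0, fun h => absurd h hm⟩
  choose A hA using hA
  let Ψ : E → (F →L[ℝ] G) := fun x => ((A 0 x).flipMultilinear).curry0
  let p : E → FormalMultilinearSeries ℝ E (F →L[ℝ] G) := fun x m => (A m x).flipMultilinear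
  have hΨ : ∀ x ∈ U, ∀ w, Ψ x w = Φ (x, w) := by
    intro x hx w
    change A 0 x w _ = _
    rw [(hA 0 (Nat.zero_le k)).1 x hx w, hP0 x hx]
  let L : (m : ℕ) → (F →L[ℝ] (E [×m]→L[ℝ] G)) →L[ℝ] (E [×m]→L[ℝ] (F →L[ℝ] G)) := fun m =>
    (ContinuousLinearMap.flipMultilinearEquiv ℝ (fun _ : Fin m => E) F G).toContinuousLinearMap
  have hplip : ∀ m, m ≤ k → LocallyLipschitzOn U (p · m) := by
    intro m hm x hx
    obtain ⟨K, t, ht, hK⟩ := (hA m hm).2 hx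
    have h := (ContinuousLinearMap.lipschitz (𝕜 := ℝ) (𝕜₂ := ℝ) (E := F →L[ℝ] (E [×m]→L[ℝ] G))
      (F := E [×m]→L[ℝ] (F →L[ℝ] G)) (σ₁₂ := RingHom.id ℝ) (L m)).comp_lipschitzOnWith hK
    exact ⟨_, t, ht, h⟩
  have hp : HasFTaylorSeriesUpToOn k Ψ p U := by
    refine ⟨fun _ _ => rfl, fun m hm x hx => ?_, fun m hm => ?_⟩
    · have hm : m < k := by exact_mod_cast hm
      let C : (E [×(m + 1)]→L[ℝ] G) →L[ℝ] (E →L[ℝ] (E [×m]→L[ℝ] G)) :=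
        (continuousMultilinearCurryLeftEquiv ℝ (fun _ : Fin (m + 1) => E)
          G).toContinuousLinearEquiv.toContinuousLinearMap
      have hAx : HasFDerivAt (A m) (C.comp (A (m + 1) x)).flip x := by
        refine hasFDerivAt_clm_of_forall_apply hU (B := fun y => C.comp (A (m + 1) y))
          (continuousOn_const.clm_comp (hA (m + 1) hm).2.continuousOn) (fun y hy w => ?_) hx
        refine HasFDerivAt.congr_of_eventuallyEq (f := fun z => P m (z, w)) ?_ (by
          filter_upwards [hU.mem_nhds hy] with z hz using (hA m hm.le).1 z hz w)
        rw [ContinuousLinearMap.comp_apply, (hA (m + 1) hm).1 y hy w]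
        exact hPderiv m hm y hy w
      have hL : HasFDerivAt (L m) (L m) (A m x) := ContinuousLinearMap.hasFDerivAt (L m)
      have h := HasFDerivAt.comp (𝕜 := ℝ) (E := E) (F := F →L[ℝ] (E [×m]→L[ℝ] G))
        (G := E [×m]→L[ℝ] (F →L[ℝ] G)) x hL hAx
      exact h.hasFDerivWithinAt
    · exact (hplip m (by exact_mod_cast hm)).continuousOn
  refine ⟨Ψ, hΨ, hp.contDiffOn, fun x hx => ?_⟩
  obtain ⟨K, t, ht, hK⟩ := hplip k le_rfl hx
  refine ⟨K, t ∩ U, inter_mem ht self_mem_nhdsWithin, ?_⟩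
  intro y hy z hz
  rw [← hp.eq_iteratedFDerivWithin_of_uniqueDiffOn le_rfl hU.uniqueDiffOn hy.2,
    ← hp.eq_iteratedFDerivWithin_of_uniqueDiffOn le_rfl hU.uniqueDiffOn hz.2]
  exact hK hy.1 hz.1
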